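/- Let B be a finite type, t ≥ 1 a natural number, and u : B → ℂ any function. For each f : B → ℤ/2ℤ define the vector φ_f ∈ ℂ^B by (φ_f)_b = (−1)^{f(b)}·u_b, and let ρ_f = (φ_f·φ_fᴴ)^{⊗t} be the t-fold Kronecker power of the rank-one matrix φ_f φ_fᴴ, a matrix indexed by B^t × B^t. Then the entry of the average (1/2^{|B|})·Σ_{f : B → ℤ/2ℤ} ρ_f at position ((b₁,…,b_t), (b'₁,…,b'_t)) equals ∏_{i=1}^t u_{b_i}·conj(u_{b'_i}) if for every c ∈ B the total count #{i : b_i = c} + #{i : b'_i = c} is even, and equals 0 otherwise. -/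

import Mathlib

open Finset

/-- The sign `(−1)^m` of `m : ZMod 2`, as a complex number. -/
def zmodTwoSign (m : ZMod 2) : ℂ := if m = 0 then 1 else -1

lemma conj_zmodTwoSign (m : ZMod 2) : starRingEnd ℂ (zmodTwoSign m) = zmodTwoSign m := by
  unfold zmodTwoSign
  split_ifs <;> simp

lemma sum_zmodTwoSign_pow (n : ℕ) :
    ∑ m : ZMod 2, zmodTwoSign m ^ n = if Even n then 2 else 0 := by
  have h : ∑ m : ZMod 2, zmodTwoSign m ^ n = zmodTwoSign 0 ^ n + zmodTwoSign 1 ^ n :=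
    Fin.sum_univ_two fun m : ZMod 2 => zmodTwoSign m ^ n
  rw [h, zmodTwoSign, zmodTwoSign, if_pos rfl, if_neg one_ne_zero, one_pow]
  split_ifs with hn
  · rw [hn.neg_one_pow, one_add_one_eq_two]
  · rw [(Nat.not_even_iff_odd.mp hn).neg_one_pow, add_neg_cancel]

/-- A monomial in random signs, with exponents `n`, sums to `2^|B|` if all exponents are even
and to `0` otherwise. -/
lemma sum_prod_zmodTwoSign_pow {B : Type*} [Fintype B] [DecidableEq B] (n : B → ℕ) :
    ∑ f : B → ZMod 2, ∏ c, zmodTwoSign (f c) ^ n c =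
      if ∀ c, Even (n c) then 2 ^ Fintype.card B else 0 := by
  rw [← Fintype.prod_sum fun c m => zmodTwoSign m ^ n c]
  simp only [sum_zmodTwoSign_pow]
  split_ifs with h
  · simp [h]
  · obtain ⟨c, hc⟩ := not_forall.mp h
    exact Finset.prod_eq_zero (Finset.mem_univ c) (if_neg hc)

lemma prod_comp_eq_prod_pow_card_fiber {ι B M : Type*} [Fintype ι] [Fintype B] [DecidableEq B]
    [CommMonoid M] (g : B → M) (b : ι → B) :
    ∏ i, g (b i) = ∏ c, g c ^ (Finset.univ.filter fun i => b i = c).card := by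
  rw [← Finset.prod_fiberwise' Finset.univ b g]
  simp only [Finset.prod_const]

/-- For `(φ_f)_b = (−1)^{f(b)}·u_b` and
`ρ_f = (φ_f φ_fᴴ)^{⊗t}` (the `t`-fold Kronecker power, realized on the index set
`B^t` via `(ρ_f)_{b,b'} = ∏ᵢ (φ_f)_{bᵢ}·conj((φ_f)_{b'ᵢ})`), the entry of the
average `(1/2^{|B|})·Σ_f ρ_f` at `(b, b')` equals `∏ᵢ u_{bᵢ}·conj(u_{b'ᵢ})` if
every `c ∈ B` satisfies `#{i : bᵢ = c} + #{i : b'ᵢ = c}` even, and `0` otherwise. -/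
theorem stmt17 (B : Type) [Fintype B] [DecidableEq B] (t : ℕ) (ht : 1 ≤ t)
    (u : B → ℂ) (b b' : Fin t → B) :
    ((1 / 2 ^ (Fintype.card B) : ℂ) *
        ∑ f : B → ZMod 2,
          ∏ i : Fin t,
            ((if f (b i) = 0 then (1 : ℂ) else -1) * u (b i) *
              starRingEnd ℂ ((if f (b' i) = 0 then (1 : ℂ) else -1) * u (b' i)))) =
      if ∀ c : B,
          Even ((Finset.univ.filter fun i : Fin t => b i = c).card +
            (Finset.univ.filter fun i : Fin t => b' i = c).card)
        then ∏ i : Fin t, u (b i) * starRingEnd ℂ (u (b' i))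
        else 0 := by
  have key (f : B → ZMod 2) :
      ∏ i : Fin t,
          ((if f (b i) = 0 then (1 : ℂ) else -1) * u (b i) *
            starRingEnd ℂ ((if f (b' i) = 0 then (1 : ℂ) else -1) * u (b' i))) =
        (∏ c, zmodTwoSign (f c) ^ ((Finset.univ.filter fun i : Fin t => b i = c).card +
            (Finset.univ.filter fun i : Fin t => b' i = c).card)) *
          ∏ i : Fin t, u (b i) * starRingEnd ℂ (u (b' i)) := by
    simp only [pow_add, Finset.prod_mul_distrib]
    rw [← prod_comp_eq_prod_pow_card_fiber (fun c => zmodTwoSign (f c)) b,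
      ← prod_comp_eq_prod_pow_card_fiber (fun c => zmodTwoSign (f c)) b']
    simp only [← Finset.prod_mul_distrib]
    refine Finset.prod_congr rfl fun i _ => ?_
    change zmodTwoSign (f (b i)) * u (b i) *
      starRingEnd ℂ (zmodTwoSign (f (b' i)) * u (b' i)) = _
    rw [map_mul, conj_zmodTwoSign]
    ring
  simp only [key]
  rw [← Finset.sum_mul, sum_prod_zmodTwoSign_pow]
  split_ifs with h
  · rw [← mul_assoc, one_div_mul_cancel (pow_ne_zero _ two_ne_zero), one_mul]
  · rw [zero_mul, mul_zero]
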